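/- Let (A,Ω) be a relative fractal drum in ℝ^N such that D := dim_B(A,Ω) exists, and fix δ > 0. Let S be a screen with sup S < D, let U be an open connected neighborhood of the associated window W, and let F be a meromorphic extension of the tube zeta function ζ̃_{A,Ω}(·;δ) to U (i.e., F(s) = ζ̃_{A,Ω}(s;δ) for all s ∈ U with Re s > D) satisfying the languidity conditions (L1)–(L2) with some exponent κ ∈ ℝ. Assume that every pole ω of F in U with Re ω < D satisfies Re ω < S(Im ω) (so the screen passes strictly between the critical line {Re s = D} and all poles of F with real part strictly less than D). Then the following are equivalent: (a) (A,Ω) is Minkowski measurable; (b) D is the only pole of F on the critical line {Re s = D}, and it is simple. Moreover, if (a) or (b) holds, then M^D(A,Ω) = r, where r := lim_{s→D}(s−D)F(s) is the residue of F at D. -/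

import Mathlib

open MeasureTheory Filter Complex Set Metric Topology Asymptotics
open scoped ENNReal NNReal

noncomputable section

/-- The open `t`-neighborhood `A_t = {x : dist(x,A) < t}` of a set `A ⊆ ℝ^N`. -/
def nbhd (N : ℕ) (A : Set (EuclideanSpace ℝ (Fin N))) (t : ℝ) :
    Set (EuclideanSpace ℝ (Fin N)) :=
  {x | Metric.infDist x A < t}

/-- The volume `|A_t ∩ Ω|` of the `t`-neighborhood of `A` relative to `Ω`. -/
def tubeVol (N : ℕ) (A Ω : Set (EuclideanSpace ℝ (Fin N))) (t : ℝ) : ℝ :=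
  (volume (nbhd N A t ∩ Ω)).toReal

/-- The upper `r`-dimensional Minkowski content of the relative fractal drum `(A,Ω)`. -/
def upperContent (N : ℕ) (A Ω : Set (EuclideanSpace ℝ (Fin N))) (r : ℝ) : ℝ≥0∞ :=
  Filter.limsup
    (fun t : ℝ => volume (nbhd N A t ∩ Ω) / ENNReal.ofReal (t ^ ((N : ℝ) - r)))
    (nhdsWithin 0 (Set.Ioi 0))

/-- The lower `r`-dimensional Minkowski content of the relative fractal drum `(A,Ω)`. -/
def lowerContent (N : ℕ) (A Ω : Set (EuclideanSpace ℝ (Fin N))) (r : ℝ) : ℝ≥0∞ :=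
  Filter.liminf
    (fun t : ℝ => volume (nbhd N A t ∩ Ω) / ENNReal.ofReal (t ^ ((N : ℝ) - r)))
    (nhdsWithin 0 (Set.Ioi 0))

/-- `D` is the (finite) upper box (Minkowski) dimension of `(A,Ω)`:
the greatest lower bound of `{r : M^{*r}(A,Ω) = 0}`. -/
def IsUpperMinkDim (N : ℕ) (A Ω : Set (EuclideanSpace ℝ (Fin N))) (D : ℝ) : Prop :=
  IsGLB {r : ℝ | upperContent N A Ω r = 0} D

/-- `D` is the (finite) lower box (Minkowski) dimension of `(A,Ω)`. -/
def IsLowerMinkDim (N : ℕ) (A Ω : Set (EuclideanSpace ℝ (Fin N))) (D : ℝ) : Prop :=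
  IsGLB {r : ℝ | lowerContent N A Ω r = 0} D

/-- The box (Minkowski) dimension of `(A,Ω)` exists and equals `D`. -/
def IsMinkDim (N : ℕ) (A Ω : Set (EuclideanSpace ℝ (Fin N))) (D : ℝ) : Prop :=
  IsUpperMinkDim N A Ω D ∧ IsLowerMinkDim N A Ω D

/-- `(A,Ω)` is a relative fractal drum in `ℝ^N`. -/
def IsRFD (N : ℕ) (A Ω : Set (EuclideanSpace ℝ (Fin N))) : Prop :=
  A.Nonempty ∧ MeasurableSet Ω ∧ volume Ω < ⊤ ∧ ∃ δ₀ > (0 : ℝ), Ω ⊆ nbhd N A δ₀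

/-- The relative distance zeta function `ζ_{A,Ω}(s) = ∫_Ω d(x,A)^{s-N} dx`. -/
def distZeta (N : ℕ) (A Ω : Set (EuclideanSpace ℝ (Fin N))) (s : ℂ) : ℂ :=
  ∫ x in Ω, (Metric.infDist x A : ℂ) ^ (s - (N : ℂ))

/-- The relative distance zeta function with parameter `δ`:
`ζ_{A,Ω}(s;δ) = ∫_{A_δ ∩ Ω} d(x,A)^{s-N} dx`. -/
def distZetaD (N : ℕ) (A Ω : Set (EuclideanSpace ℝ (Fin N))) (δ : ℝ) (s : ℂ) : ℂ :=
  ∫ x in nbhd N A δ ∩ Ω, (Metric.infDist x A : ℂ) ^ (s - (N : ℂ))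

/-- The relative tube zeta function `ζ̃_{A,Ω}(s;δ) = ∫_0^δ t^{s-N-1}|A_t ∩ Ω| dt`. -/
def tubeZeta (N : ℕ) (A Ω : Set (EuclideanSpace ℝ (Fin N))) (δ : ℝ) (s : ℂ) : ℂ :=
  ∫ t in Set.Ioc (0 : ℝ) δ, (t : ℂ) ^ (s - (N : ℂ) - 1) * ((tubeVol N A Ω t : ℝ) : ℂ)

/-- The Mellin zeta function `ζ^𝔐_{A,Ω}(s) = ∫_0^∞ t^{s-N-1}|A_t ∩ Ω| dt`. -/
def mellinZeta (N : ℕ) (A Ω : Set (EuclideanSpace ℝ (Fin N))) (s : ℂ) : ℂ :=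
  ∫ t in Set.Ioi (0 : ℝ), (t : ℂ) ^ (s - (N : ℂ) - 1) * ((tubeVol N A Ω t : ℝ) : ℂ)

/-- `(A,Ω)` is Minkowski measurable with dimension `D` and Minkowski content `M`. -/
def MinkMeasurable (N : ℕ) (A Ω : Set (EuclideanSpace ℝ (Fin N))) (D M : ℝ) : Prop :=
  0 < M ∧
    Tendsto (fun t : ℝ => tubeVol N A Ω t / t ^ ((N : ℝ) - D))
      (nhdsWithin 0 (Set.Ioi 0)) (nhds M)

/-- `ω` is a pole of `F` (the norm of `F` blows up at `ω`). -/
def IsPoleAt (F : ℂ → ℂ) (ω : ℂ) : Prop :=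
  Tendsto (fun s => ‖F s‖) (nhdsWithin ω {ω}ᶜ) atTop

/-- The languidity conditions **L1**–**L2** for `F` with screen `S`, exponent `κ`,
constants `c`, `C` and two-sided sequence `T`. -/
def LanguidWith (F : ℂ → ℂ) (S : ℝ → ℝ) (κ c C : ℝ) (T : ℤ → ℝ) : Prop :=
  0 < C ∧
  (∀ n : ℤ, 1 ≤ n → T (-n) < 0 ∧ 0 < T n) ∧
  Tendsto (fun n : ℕ => T (n : ℤ)) atTop atTop ∧
  Tendsto (fun n : ℕ => T (-(n : ℤ))) atTop atBot ∧
  (∀ n : ℤ, ∀ σ : ℝ, S (T n) < σ → σ < c →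
    ‖F ((σ : ℂ) + (T n : ℝ) * Complex.I)‖ ≤ C * (|T n| + 1) ^ κ) ∧
  (∀ τ : ℝ, 1 ≤ |τ| → ‖F ((S τ : ℂ) + (τ : ℝ) * Complex.I)‖ ≤ C * |τ| ^ κ)

/-- `S` is a screen (for upper box dimension `D`): a Lipschitz function bounded below,
with `sup S ≤ D`. -/
def IsScreen (S : ℝ → ℝ) (D : ℝ) : Prop :=
  (∃ K : NNReal, LipschitzWith K S) ∧ BddBelow (Set.range S) ∧ ∀ τ : ℝ, S τ ≤ D

/-- The window associated with the screen `S`. -/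
def window (S : ℝ → ℝ) : Set ℂ :=
  {s : ℂ | S s.im ≤ s.re}


/-- The Fejér kernel `w ↦ (sin (w / 2) / (w / 2)) ^ 2`. -/
def fejerKernel (w : ℝ) : ℝ := Real.sinc (w / 2) ^ 2

/-- The triangle function supported on `[-1, 1]`. -/
def triangle (s : ℝ) : ℝ := max (1 - |s|) 0

lemma continuous_triangle : Continuous triangle := by
  unfold triangle; fun_prop

lemma triangle_nonneg (s : ℝ) : 0 ≤ triangle s := le_max_right _ _

lemma triangle_eq_zero {s : ℝ} (hs : 1 ≤ |s|) : triangle s = 0 :=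
  max_eq_right (by linarith)

lemma integrable_triangle : Integrable triangle := by
  refine continuous_triangle.integrable_of_hasCompactSupport
    (HasCompactSupport.intro (isCompact_Icc (a := (-1 : ℝ)) (b := 1)) fun s hs => ?_)
  refine triangle_eq_zero ?_
  by_contra! h
  exact hs ⟨(abs_lt.1 h).1.le, (abs_lt.1 h).2.le⟩

lemma fejerKernel_nonneg (w : ℝ) : 0 ≤ fejerKernel w := sq_nonneg _

lemma continuous_fejerKernel : Continuous fejerKernel := by
  unfold fejerKernel
  have := Real.continuous_sinc
  fun_prop

lemma fejerKernel_le_one (w : ℝ) : fejerKernel w ≤ 1 := by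
  have := Real.abs_sinc_le_one (w / 2)
  unfold fejerKernel
  rwa [← sq_abs, sq_le_one_iff₀ (abs_nonneg _)]

lemma sq_mul_fejerKernel (w : ℝ) : w ^ 2 * fejerKernel w = 4 * Real.sin (w / 2) ^ 2 := by
  rcases eq_or_ne w 0 with rfl | hw
  · simp
  · rw [fejerKernel, Real.sinc_of_ne_zero (by positivity)]
    field_simp
    ring

lemma integrable_fejerKernel : Integrable fejerKernel := by
  refine (integrable_inv_one_add_sq.const_mul 5).mono'
    continuous_fejerKernel.aestronglyMeasurable (ae_of_all _ fun w => ?_)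
  rw [Real.norm_of_nonneg (fejerKernel_nonneg w), ← div_eq_mul_inv, le_div_iff₀ (by positivity)]
  nlinarith [sq_mul_fejerKernel w, fejerKernel_le_one w, Real.sin_sq_le_one (w / 2)]

lemma integral_fejerKernel_pos : 0 < ∫ w, fejerKernel w := by
  refine integral_pos_of_integrable_nonneg_nonzero (x := 0) continuous_fejerKernel
    integrable_fejerKernel fejerKernel_nonneg ?_
  simp [fejerKernel]

lemma integral_one_sub_mul_cexp {z : ℂ} (hz : z ≠ 0) :
    ∫ s in (0 : ℝ)..1, (1 - s : ℂ) * cexp (z * s) =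
      cexp z / z ^ 2 - 1 / z - 1 / z ^ 2 := by
  have hd (s : ℝ) : HasDerivAt (fun s : ℝ => (1 - s : ℂ) * cexp (z * s) / z +
      cexp (z * s) / z ^ 2) ((1 - s : ℂ) * cexp (z * s)) s := by
    have h0 : HasDerivAt (fun s : ℝ => (s : ℂ)) 1 s := ofRealCLM.hasDerivAt
    have h1 := (h0.const_mul z).cexp
    have h2 := (((h0.const_sub 1).mul h1).div_const z).add (h1.div_const (z ^ 2))
    convert! h2 using 1
    field_simp
    ring
  rw [intervalIntegral.integral_eq_sub_of_hasDerivAt (fun s _ => hd s)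
    (Continuous.intervalIntegrable (by fun_prop) _ _)]
  simp
  ring

lemma integral_triangle_mul_cexp (w : ℝ) :
    ∫ s : ℝ, (triangle s : ℂ) * cexp (I * w * s) = fejerKernel w := by
  have hcont (w : ℝ) : Continuous fun s : ℝ => (triangle s : ℂ) * cexp (I * w * s) := by
    have := continuous_triangle
    fun_prop
  have hhalf (w : ℝ) : ∫ s in (0 : ℝ)..1, (triangle s : ℂ) * cexp (I * w * s) =
      ∫ s in (0 : ℝ)..1, (1 - s : ℂ) * cexp (I * w * s) := by
    refine intervalIntegral.integral_congr fun s hs => ?_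
    rw [uIcc_of_le zero_le_one] at hs
    simp only [triangle, abs_of_nonneg hs.1]
    rw [max_eq_left (by linarith [hs.2])]
    push_cast
    ring
  have hneg : ∫ s in (-1 : ℝ)..0, (triangle s : ℂ) * cexp (I * w * s) =
      ∫ s in (0 : ℝ)..1, (triangle s : ℂ) * cexp (I * (-w : ℝ) * s) := by
    have := intervalIntegral.integral_comp_neg (a := 0) (b := 1)
      fun s : ℝ => (triangle s : ℂ) * cexp (I * w * s)
    simp only [neg_zero] at this
    rw [← this]
    refine intervalIntegral.integral_congr fun s _ => ?_
    simp [triangle]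
  have hsupp : ∫ s : ℝ, (triangle s : ℂ) * cexp (I * w * s) =
      ∫ s in (-1 : ℝ)..1, (triangle s : ℂ) * cexp (I * w * s) := by
    rw [intervalIntegral.integral_of_le (by norm_num), eq_comm]
    refine setIntegral_eq_integral_of_forall_compl_eq_zero fun s hs => ?_
    rw [triangle_eq_zero]
    · simp
    by_contra! h
    exact hs ⟨(abs_lt.1 h).1, (abs_lt.1 h).2.le⟩
  rw [hsupp, ← intervalIntegral.integral_add_adjacent_intervals
    ((hcont w).intervalIntegrable _ 0) ((hcont w).intervalIntegrable _ _), hneg, hhalf, hhalf]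
  rcases eq_or_ne w 0 with rfl | hw
  · have : ∫ s in (0 : ℝ)..1, (1 - s : ℂ) = 1 / 2 := by
      have h : ∫ s in (0 : ℝ)..1, ((1 - s : ℝ) : ℂ) = ((∫ s in (0 : ℝ)..1, (1 - s) : ℝ) : ℂ) :=
        intervalIntegral.integral_ofReal
      push_cast at h
      rw [h, intervalIntegral.integral_sub (by simp) (by simp)]
      norm_num
    simp [this, fejerKernel]
    norm_num
  · have hw' : (w : ℂ) ≠ 0 := by exact_mod_cast hw
    rw [integral_one_sub_mul_cexp (mul_ne_zero I_ne_zero hw'),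
      integral_one_sub_mul_cexp (mul_ne_zero I_ne_zero (by simpa using hw))]
    have h1 : (fejerKernel w : ℂ) = 4 * Complex.sin (w / 2) ^ 2 / w ^ 2 := by
      rw [eq_div_iff (pow_ne_zero 2 hw'), mul_comm]
      exact_mod_cast congrArg ((↑) : ℝ → ℂ) (sq_mul_fejerKernel w)
    have h2 : 4 * Complex.sin (w / 2) ^ 2 = 2 - 2 * Complex.cos w := by
      have := Complex.cos_two_mul (w / 2 : ℂ)
      rw [mul_div_cancel₀ _ two_ne_zero] at this
      rw [this, Complex.sin_sq]
      ring
    have h3 : 2 * Complex.cos w = cexp (I * w) + cexp (-(I * w)) := by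
      rw [Complex.two_cos, mul_comm I, neg_mul]
    rw [h1, h2, h3]
    push_cast
    rw [mul_neg]
    field_simp
    rw [Complex.I_sq]
    ring

/-- The Laplace transform `∫_0^∞ e^{-zx} w(x) dx`. -/
def laplaceInt (w : ℝ → ℝ) (z : ℂ) : ℂ := ∫ x in Ioi (0 : ℝ), cexp (-z * x) * w x

/-- `w` grows subexponentially on `[0, ∞)`. -/
def Subexponential (w : ℝ → ℝ) : Prop :=
  ∀ ε > 0, ∃ B, ∀ x ≥ 0, |w x| ≤ B * Real.exp (ε * x)

lemma Subexponential.sub_const {w : ℝ → ℝ} (hw : Subexponential w) (r : ℝ) :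
    Subexponential fun x => w x - r := fun ε hε => by
  obtain ⟨B, hB⟩ := hw ε hε
  refine ⟨B + |r|, fun x hx => (abs_sub _ _).trans ?_⟩
  have : 1 ≤ Real.exp (ε * x) := Real.one_le_exp (by positivity)
  nlinarith [hB x hx, abs_nonneg r]

lemma Subexponential.integrableOn_exp_mul {w : ℝ → ℝ} (hm : Measurable w)
    (hw : Subexponential w) {ε : ℝ} (hε : 0 < ε) :
    IntegrableOn (fun x => Real.exp (-ε * x) * w x) (Ioi 0) := by
  obtain ⟨B, hB⟩ := hw (ε / 2) (by positivity)
  refine ((integrableOn_exp_mul_Ioi (a := -(ε / 2)) (by linarith) 0).const_mul B).mono'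
    (by fun_prop) ((ae_restrict_iff' measurableSet_Ioi).2 (ae_of_all _ fun x hx => ?_))
  rw [norm_mul, Real.norm_of_nonneg (Real.exp_nonneg _), Real.norm_eq_abs]
  calc Real.exp (-ε * x) * |w x| ≤ Real.exp (-ε * x) * (B * Real.exp (ε / 2 * x)) := by
        gcongr; exact hB x (le_of_lt hx)
    _ = B * Real.exp (-(ε / 2) * x) := by
        rw [mul_left_comm, ← Real.exp_add]; ring_nf

lemma Subexponential.integrableOn_cexp_mul {w : ℝ → ℝ} (hm : Measurable w)
    (hw : Subexponential w) {z : ℂ} (hz : 0 < z.re) :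
    IntegrableOn (fun x : ℝ => cexp (-z * x) * w x) (Ioi 0) := by
  refine (hw.integrableOn_exp_mul hm hz).norm.mono' (by fun_prop) (ae_of_all _ fun x => ?_)
  simp [Complex.norm_exp]

lemma Subexponential.continuousAt_laplaceInt {w : ℝ → ℝ} (hm : Measurable w)
    (hw : Subexponential w) {z : ℂ} (hz : 0 < z.re) : ContinuousAt (laplaceInt w) z := by
  refine continuousAt_of_dominated (Eventually.of_forall fun z => by fun_prop) ?_
    (hw.integrableOn_exp_mul hm (half_pos hz)).norm (ae_of_all _ fun x => by fun_prop)
  filter_upwards [Complex.continuous_re.continuousAt.eventually (lt_mem_nhds (half_lt_self hz))]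
    with z' hz'
  refine (ae_restrict_iff' measurableSet_Ioi).2 (ae_of_all _ fun x hx => ?_)
  rw [norm_mul, norm_mul, Complex.norm_exp, Complex.norm_real, Real.norm_eq_abs (Real.exp _),
    Real.abs_exp]
  have : 0 < x := hx
  gcongr
  simp
  nlinarith

lemma laplaceInt_sub_const {w : ℝ → ℝ} (hm : Measurable w) (hw : Subexponential w) (r : ℝ)
    {z : ℂ} (hz : 0 < z.re) : laplaceInt (fun x => w x - r) z = laplaceInt w z - r / z := by
  have h1 : ∫ x in Ioi (0 : ℝ), cexp (-z * x) * (r : ℂ) = r / z := by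
    rw [integral_mul_const, integral_exp_mul_complex_Ioi (by simpa using hz)]
    simp [div_eq_inv_mul]
  rw [← h1, laplaceInt, laplaceInt, ← integral_sub (hw.integrableOn_cexp_mul hm hz)
    ((integrableOn_exp_mul_complex_Ioi (by simpa using hz) 0).mul_const _)]
  refine integral_congr_ae (ae_of_all _ fun x => ?_)
  push_cast
  ring

/-- Smoothing a Laplace transform on a vertical line with the triangle function amounts to
convolving with the Fejér kernel. -/
lemma integral_triangle_mul_laplaceInt {w : ℝ → ℝ} (hm : Measurable w) (hw : Subexponential w)
    {ε : ℝ} (hε : 0 < ε) (lam y : ℝ) :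
    ∫ s : ℝ, (triangle s : ℂ) * cexp (I * (lam * y : ℝ) * s) *
        laplaceInt w (ε + (lam * s : ℝ) * I) =
      ((∫ x in Ioi (0 : ℝ), Real.exp (-ε * x) * w x * fejerKernel (lam * (y - x)) : ℝ) : ℂ) := by
  have htri := continuous_triangle
  calc ∫ s : ℝ, (triangle s : ℂ) * cexp (I * (lam * y : ℝ) * s) *
        laplaceInt w (ε + (lam * s : ℝ) * I)
      = ∫ s : ℝ, ∫ x in Ioi (0 : ℝ), (triangle s : ℂ) * cexp (I * (lam * y : ℝ) * s) *
          (cexp (-(ε + (lam * s : ℝ) * I) * x) * w x) := by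
        simp_rw [laplaceInt, integral_const_mul]
    _ = ∫ x in Ioi (0 : ℝ), ∫ s : ℝ, (triangle s : ℂ) * cexp (I * (lam * y : ℝ) * s) *
          (cexp (-(ε + (lam * s : ℝ) * I) * x) * w x) := by
        refine integral_integral_swap ?_
        refine (integrable_triangle.mul_prod (hw.integrableOn_exp_mul hm hε)).mono
          ?_ (ae_of_all _ fun p => le_of_eq ?_)
        · refine Measurable.aestronglyMeasurable ?_
          simp only [Function.uncurry_def]
          have := htri.measurable
          fun_prop
        · simp [Function.uncurry, Complex.norm_exp]
    _ = ∫ x in Ioi (0 : ℝ),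
          ((Real.exp (-ε * x) * w x * fejerKernel (lam * (y - x)) : ℝ) : ℂ) := by
        refine integral_congr_ae (ae_of_all _ fun x => ?_)
        simp only
        push_cast
        rw [← integral_triangle_mul_cexp, ← integral_const_mul]
        refine integral_congr_ae (ae_of_all _ fun s => ?_)
        have : cexp (I * (lam * y) * s) * cexp (-(ε + (lam * s) * I) * x) =
            cexp (-ε * x) * cexp (I * (lam * (y - x) : ℝ) * s) := by
          rw [← Complex.exp_add, ← Complex.exp_add]
          push_cast
          ring_nf
        push_cast at this ⊢
        linear_combination (triangle s : ℂ) * w x * this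
    _ = _ := integral_ofReal

lemma integrable_fejerKernel_comp {lam : ℝ} (hlam : 0 < lam) (y : ℝ) :
    Integrable fun x => fejerKernel (lam * (y - x)) :=
  (integrable_fejerKernel.comp_mul_left' hlam.ne').comp_sub_left y

lemma integral_fejerKernel_comp {lam : ℝ} (hlam : 0 < lam) (y : ℝ) :
    ∫ x, fejerKernel (lam * (y - x)) = lam⁻¹ * ∫ x, fejerKernel x := by
  rw [integral_sub_left_eq_self (fun x => fejerKernel (lam * x)) volume y,
    Measure.integral_comp_mul_left, abs_of_pos (inv_pos.2 hlam), smul_eq_mul]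

lemma tendsto_setIntegral_fejerKernel_comp {lam : ℝ} (hlam : 0 < lam) :
    Tendsto (fun y => ∫ x in Ioi (0 : ℝ), fejerKernel (lam * (y - x))) atTop
      (𝓝 (lam⁻¹ * ∫ x, fejerKernel x)) := by
  have h := (aecover_Iio (μ := volume) (tendsto_id (α := ℝ) (x := atTop))
    ).integral_tendsto_of_countably_generated (integrable_fejerKernel.comp_mul_left' hlam.ne')
  rw [Measure.integral_comp_mul_left, abs_of_pos (inv_pos.2 hlam), smul_eq_mul] at h
  refine h.congr fun y => ?_
  rw [← integral_indicator measurableSet_Iio, ← integral_indicator measurableSet_Ioi,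
    ← integral_sub_left_eq_self _ volume y]
  refine integral_congr_ae (ae_of_all _ fun x => ?_)
  simp [indicator]

/-- If the Laplace transform of `u - r` extends continuously to the closed right half-plane, then
the convolutions of `u` with rescaled Fejér kernels exist and have the expected limits. -/
lemma exists_fejer_convolution {u : ℝ → ℝ} {r : ℝ} (hm : Measurable u)
    (h0 : ∀ x, 0 ≤ u x) (hu : Subexponential u) {H : ℂ → ℂ}
    (hH : ContinuousOn H {z | 0 ≤ z.re})
    (hHu : ∀ z : ℂ, 0 < z.re → H z = laplaceInt u z - r / z) {lam : ℝ} (hlam : 0 < lam) :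
    (∀ y, IntegrableOn (fun x => u x * fejerKernel (lam * (y - x))) (Ioi 0)) ∧
      Tendsto (fun y => ∫ x in Ioi (0 : ℝ), u x * fejerKernel (lam * (y - x))) atTop
        (𝓝 (r * (lam⁻¹ * ∫ x, fejerKernel x))) := by
  have htri := continuous_triangle
  have hK := continuous_fejerKernel
  set h : ℝ → ℂ := fun y => ∫ s : ℝ, (triangle s : ℂ) * cexp (I * (lam * y : ℝ) * s) *
    H ((lam * s : ℝ) * I) with hdef
  have hlim : Tendsto h atTop (𝓝 0) := by
    have hRL := (Real.tendsto_integral_exp_smul_cocompact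
      (fun s : ℝ => (triangle s : ℂ) * H ((lam * s : ℝ) * I))).comp
      ((tendsto_neg_atTop_atBot.comp (tendsto_id.const_mul_atTop
        (show 0 < lam / (2 * Real.pi) by positivity))).mono_right atBot_le_cocompact)
    refine hRL.congr fun y => ?_
    simp only [Function.comp_apply, hdef, id]
    refine integral_congr_ae (ae_of_all _ fun s => ?_)
    simp only [Circle.smul_def, Real.fourierChar_apply, smul_eq_mul]
    have : ((2 * Real.pi * -(s * -(lam / (2 * Real.pi) * y)) : ℝ) : ℂ) * I =
        I * (lam * y : ℝ) * s := by
      have : 2 * Real.pi * -(s * -(lam / (2 * Real.pi) * y)) = lam * y * s := by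
        field_simp
      rw [this]; push_cast; ring
    rw [this]
    ring
  set e : ℕ → ℝ := fun n => 1 / ((n : ℝ) + 1) with he
  have he0 (n : ℕ) : 0 < e n := by simp only [he]; positivity
  have he1 (n : ℕ) : e n ≤ 1 := by
    simp only [he]
    rw [div_le_one (by positivity)]
    linarith [n.cast_nonneg (α := ℝ)]
  have heT : Tendsto e atTop (𝓝 0) := tendsto_one_div_add_atTop_nhds_zero_nat
  have hexp (x : ℝ) : Tendsto (fun n => Real.exp (-e n * x)) atTop (𝓝 1) := by
    have := (Real.continuous_exp.tendsto _).comp (heT.neg.mul_const x)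
    simpa [Function.comp_def] using this
  -- the smoothed difference converges as the abscissa tends to zero
  have hA (y : ℝ) : Tendsto (fun n => ∫ x in Ioi (0 : ℝ),
      Real.exp (-e n * x) * (u x - r) * fejerKernel (lam * (y - x))) atTop (𝓝 (h y).re) := by
    have hpt (n : ℕ) (s : ℝ) : H (e n + (lam * s : ℝ) * I) =
        laplaceInt (fun x => u x - r) (e n + (lam * s : ℝ) * I) := by
      have : 0 < ((e n : ℂ) + (lam * s : ℝ) * I).re := by simpa using he0 n
      rw [laplaceInt_sub_const hm hu r this, hHu _ this]
    obtain ⟨M, hM⟩ := ((isCompact_Icc (a := (0 : ℝ)) (b := 1)).reProdIm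
      (isCompact_Icc (a := -lam) (b := lam))).exists_bound_of_continuousOn
      (hH.mono fun z hz => hz.1.1)
    have hc (a : ℝ) (ha : 0 ≤ a) : Continuous fun s : ℝ => H (a + (lam * s : ℝ) * I) :=
      hH.comp_continuous (by fun_prop) fun s => by simpa using ha
    have hD : Tendsto (fun n => ∫ s : ℝ, (triangle s : ℂ) * cexp (I * (lam * y : ℝ) * s) *
        H (e n + (lam * s : ℝ) * I)) atTop (𝓝 (h y)) := by
      refine tendsto_integral_of_dominated_convergence (fun s => triangle s * M) (fun n => ?_)
        (integrable_triangle.mul_const M) (fun n => ae_of_all _ fun s => ?_)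
        (ae_of_all _ fun s => ?_)
      · exact (Continuous.mul (by fun_prop) (hc (e n) (he0 n).le)).aestronglyMeasurable
      · rw [norm_mul, norm_mul]
        have h1 : ‖cexp (I * (lam * y : ℝ) * s)‖ = 1 := by simp [Complex.norm_exp]
        rw [h1, mul_one, Complex.norm_real, Real.norm_of_nonneg (triangle_nonneg s)]
        by_cases hs : 1 ≤ |s|
        · simp [triangle_eq_zero hs]
        · refine mul_le_mul_of_nonneg_left (hM _ ?_) (triangle_nonneg s)
          have := abs_lt.1 (not_le.1 hs)
          refine ⟨?_, ?_⟩
          · simpa using ⟨(he0 n).le, he1 n⟩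
          · simp only [mem_preimage, mem_Icc]
            simp
            constructor <;> nlinarith
      · refine Tendsto.const_mul _ ?_
        have hin : Tendsto (fun n => (e n : ℂ) + (lam * s : ℝ) * I) atTop
            (𝓝[{z | 0 ≤ z.re}] ((lam * s : ℝ) * I)) := by
          refine tendsto_nhdsWithin_iff.2 ⟨?_, Eventually.of_forall fun n => ?_⟩
          · have := ((Complex.continuous_ofReal.tendsto 0).comp heT).add_const
              ((lam * s : ℝ) * I)
            simpa using this
          · simpa using (he0 n).le
        exact (hH ((lam * s : ℝ) * I) (by simp)).tendsto.comp hin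
    simp_rw [hpt, integral_triangle_mul_laplaceInt (hm.sub_const r) (hu.sub_const r) (he0 _)]
      at hD
    exact (Complex.continuous_re.tendsto _).comp hD
  have hB (y : ℝ) : Tendsto (fun n => ∫ x in Ioi (0 : ℝ),
      Real.exp (-e n * x) * fejerKernel (lam * (y - x))) atTop
      (𝓝 (∫ x in Ioi (0 : ℝ), fejerKernel (lam * (y - x)))) := by
    refine tendsto_integral_of_dominated_convergence (fun x => fejerKernel (lam * (y - x)))
      (fun n => by fun_prop) (integrable_fejerKernel_comp hlam y).integrableOn
      (fun n => (ae_restrict_iff' measurableSet_Ioi).2 (ae_of_all _ fun x hx => ?_))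
      (ae_of_all _ fun x => ?_)
    · rw [norm_mul, Real.norm_of_nonneg (Real.exp_nonneg _),
        Real.norm_of_nonneg (fejerKernel_nonneg _)]
      refine mul_le_of_le_one_left (fejerKernel_nonneg _) (Real.exp_le_one_iff.2 ?_)
      nlinarith [he0 n, mem_Ioi.1 hx]
    · simpa using (hexp x).mul_const (fejerKernel (lam * (y - x)))
  have hint (n : ℕ) (y : ℝ) {w : ℝ → ℝ} (hwm : Measurable w) (hw : Subexponential w) :
      IntegrableOn (fun x => Real.exp (-e n * x) * w x * fejerKernel (lam * (y - x)))
        (Ioi 0) := by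
    refine (hw.integrableOn_exp_mul hwm (he0 n)).mul_bdd (c := 1)
      (by fun_prop) (ae_of_all _ fun x => ?_)
    rw [Real.norm_of_nonneg (fejerKernel_nonneg _)]
    exact fejerKernel_le_one _
  have hAB (y : ℝ) : Tendsto (fun n => ∫ x in Ioi (0 : ℝ),
      Real.exp (-e n * x) * u x * fejerKernel (lam * (y - x))) atTop
      (𝓝 ((h y).re + r * ∫ x in Ioi (0 : ℝ), fejerKernel (lam * (y - x)))) := by
    refine ((hA y).add ((hB y).const_mul r)).congr fun n => ?_
    rw [← integral_const_mul, ← integral_add (hint n y (hm.sub_const r) (hu.sub_const r))]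
    · refine integral_congr_ae (ae_of_all _ fun x => ?_)
      simp only
      ring
    · have := (hint n y (w := fun _ => r) measurable_const fun ε hε => ⟨|r|, fun x hx =>
        le_mul_of_one_le_right (abs_nonneg r) (Real.one_le_exp (by positivity))⟩)
      refine this.congr (ae_of_all _ fun x => ?_)
      simp only
      ring
  have hptw (y x : ℝ) : Tendsto (fun n => Real.exp (-e n * x) * u x *
      fejerKernel (lam * (y - x))) atTop (𝓝 (u x * fejerKernel (lam * (y - x)))) := by
    simpa using ((hexp x).mul_const (u x)).mul_const (fejerKernel (lam * (y - x)))
  have hI (y : ℝ) : IntegrableOn (fun x => u x * fejerKernel (lam * (y - x))) (Ioi 0) := by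
    refine integrable_of_tendsto (ae_of_all _ (hptw y))
      (fun n => (hint n y hm hu).aestronglyMeasurable) ?_
    have : (fun n => ∫⁻ x in Ioi (0 : ℝ),
        ‖Real.exp (-e n * x) * u x * fejerKernel (lam * (y - x))‖ₑ) = fun n =>
        ENNReal.ofReal (∫ x in Ioi (0 : ℝ),
          Real.exp (-e n * x) * u x * fejerKernel (lam * (y - x))) := by
      funext n
      have hnn (x : ℝ) : 0 ≤ Real.exp (-e n * x) * u x * fejerKernel (lam * (y - x)) :=
        mul_nonneg (mul_nonneg (Real.exp_nonneg _) (h0 x)) (fejerKernel_nonneg _)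
      rw [ofReal_integral_eq_lintegral_ofReal (hint n y hm hu) (ae_of_all _ hnn)]
      exact lintegral_congr fun x => Real.enorm_of_nonneg (hnn x)
    rw [this, (ENNReal.tendsto_ofReal (hAB y)).liminf_eq]
    exact ENNReal.ofReal_ne_top
  refine ⟨hI, ?_⟩
  have hval (y : ℝ) : ∫ x in Ioi (0 : ℝ), u x * fejerKernel (lam * (y - x)) =
      (h y).re + r * ∫ x in Ioi (0 : ℝ), fejerKernel (lam * (y - x)) := by
    refine tendsto_nhds_unique ?_ (hAB y)
    refine tendsto_integral_of_dominated_convergence _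
      (fun n => (hint n y hm hu).aestronglyMeasurable) (hI y)
      (fun n => (ae_restrict_iff' measurableSet_Ioi).2 (ae_of_all _ fun x hx => ?_))
      (ae_of_all _ (hptw y))
    rw [mul_assoc, norm_mul, Real.norm_of_nonneg (Real.exp_nonneg _), Real.norm_of_nonneg
      (mul_nonneg (h0 x) (fejerKernel_nonneg _))]
    refine mul_le_of_le_one_left (mul_nonneg (h0 x) (fejerKernel_nonneg _))
      (Real.exp_le_one_iff.2 ?_)
    nlinarith [he0 n, mem_Ioi.1 hx]
  simp_rw [hval]
  simpa using ((Complex.continuous_re.tendsto _).comp hlim).add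
    ((tendsto_setIntegral_fejerKernel_comp hlam).const_mul r)

lemma setIntegral_fejerKernel_Ioc {lam : ℝ} (hlam : 0 < lam) {a : ℝ} (ha : 0 < a) (y : ℝ) :
    ∫ x in Ioc (y - a) (y + a), fejerKernel (lam * (y - x)) =
      lam⁻¹ * ∫ w in (-(lam * a))..(lam * a), fejerKernel w := by
  rw [← intervalIntegral.integral_of_le (by linarith),
    intervalIntegral.integral_comp_sub_left (fun x => fejerKernel (lam * x)),
    intervalIntegral.integral_comp_mul_left _ hlam.ne', smul_eq_mul]
  ring_nf

section Tauberian

variable {u : ℝ → ℝ} {C : ℝ}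

lemma le_exp_mul_of_growth (h0 : ∀ x, 0 ≤ u x) (hC : 0 ≤ C)
    (hgrow : ∀ x ≥ 0, ∀ t ≥ 0, u (x + t) ≤ Real.exp (C * t) * u x) {x Y : ℝ} (hx : 0 ≤ x)
    (hxY : x ≤ Y) : u x ≤ Real.exp (C * Y) * u 0 := by
  have := hgrow 0 le_rfl x hx
  rw [zero_add] at this
  refine this.trans (mul_le_mul_of_nonneg_right (Real.exp_le_exp.2 ?_) (h0 0))
  exact mul_le_mul_of_nonneg_left hxY hC

lemma exists_bound_of_growth (h0 : ∀ x, 0 ≤ u x) (hC : 0 ≤ C)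
    (hgrow : ∀ x ≥ 0, ∀ t ≥ 0, u (x + t) ≤ Real.exp (C * t) * u x) {b : ℝ}
    (hb : ∀ᶠ x in atTop, u x < b) : ∃ B, ∀ x ≥ 0, u x ≤ B := by
  obtain ⟨Y, hY⟩ := eventually_atTop.1 hb
  refine ⟨max b (Real.exp (C * Y) * u 0), fun x hx => ?_⟩
  rcases le_total Y x with h | h
  · exact le_max_of_le_left (hY x h).le
  · exact le_max_of_le_right (le_exp_mul_of_growth h0 hC hgrow hx h)

/-- Lower bound for the Fejér convolution of a function of at most exponential increase. -/
lemma le_fejer_convolution (h0 : ∀ x, 0 ≤ u x) (hC : 0 ≤ C)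
    (hgrow : ∀ x ≥ 0, ∀ t ≥ 0, u (x + t) ≤ Real.exp (C * t) * u x)
    {lam : ℝ} (hlam : 0 < lam) {a y : ℝ} (ha : 0 < a) (hy : a ≤ y)
    (hint : IntegrableOn (fun x => u x * fejerKernel (lam * (y - x))) (Ioi 0)) :
    u (y + a) * (lam⁻¹ * ∫ w in (-(lam * a))..(lam * a), fejerKernel w) ≤
      Real.exp (C * (2 * a)) * ∫ x in Ioi (0 : ℝ), u x * fejerKernel (lam * (y - x)) := by
  have hsub : Ioc (y - a) (y + a) ⊆ Ioi 0 := fun x hx => mem_Ioi.2 (by linarith [hx.1])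
  rw [← setIntegral_fejerKernel_Ioc hlam ha, ← integral_const_mul, ← integral_const_mul]
  refine le_trans (setIntegral_mono_on
    ((integrable_fejerKernel_comp hlam y).integrableOn.const_mul _)
    ((hint.mono_set hsub).const_mul _) measurableSet_Ioc fun x hx => ?_)
    (setIntegral_mono_set (hint.const_mul _) (ae_of_all _ fun x =>
      mul_nonneg (Real.exp_nonneg _) (mul_nonneg (h0 x) (fejerKernel_nonneg _)))
      hsub.eventuallyLE)
  rw [← mul_assoc]
  refine mul_le_mul_of_nonneg_right ?_ (fejerKernel_nonneg _)
  have h1 := hgrow x (by linarith [hx.1]) (y + a - x) (by linarith [hx.2])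
  rw [add_sub_cancel] at h1
  refine h1.trans (mul_le_mul_of_nonneg_right (Real.exp_le_exp.2 ?_) (h0 x))
  exact mul_le_mul_of_nonneg_left (by linarith [hx.1]) hC

/-- Upper bound for the Fejér convolution of a bounded function of at most exponential
increase. -/
lemma fejer_convolution_le (h0 : ∀ x, 0 ≤ u x) (hC : 0 ≤ C)
    (hgrow : ∀ x ≥ 0, ∀ t ≥ 0, u (x + t) ≤ Real.exp (C * t) * u x)
    {B : ℝ} (hB : ∀ x ≥ 0, u x ≤ B)
    {lam : ℝ} (hlam : 0 < lam) {a y : ℝ} (ha : 0 < a) (hy : a ≤ y)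
    (hint : IntegrableOn (fun x => u x * fejerKernel (lam * (y - x))) (Ioi 0)) :
    ∫ x in Ioi (0 : ℝ), u x * fejerKernel (lam * (y - x)) ≤
      lam⁻¹ * (Real.exp (C * (2 * a)) * u (y - a) * (∫ w, fejerKernel w) +
        B * ((∫ w, fejerKernel w) - ∫ w in (-(lam * a))..(lam * a), fejerKernel w)) := by
  set k : ℝ → ℝ := fun x => fejerKernel (lam * (y - x)) with hk
  set E := Real.exp (C * (2 * a)) * u (y - a) with hE
  have hE0 : 0 ≤ E := mul_nonneg (Real.exp_nonneg _) (h0 _)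
  have hB0 : 0 ≤ B := (h0 0).trans (hB 0 le_rfl)
  have hki : Integrable k := integrable_fejerKernel_comp hlam y
  have hk0 (x : ℝ) : 0 ≤ k x := fejerKernel_nonneg _
  set J := Ioc (y - a) (y + a) with hJ
  have hgi : Integrable fun x => J.indicator (fun x => E * k x) x +
      Jᶜ.indicator (fun x => B * k x) x :=
    ((hki.const_mul E).indicator measurableSet_Ioc).add
      ((hki.const_mul B).indicator measurableSet_Ioc.compl)
  have hg0 (x : ℝ) : 0 ≤ J.indicator (fun x => E * k x) x +
      Jᶜ.indicator (fun x => B * k x) x :=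
    add_nonneg (indicator_nonneg (fun x _ => mul_nonneg hE0 (hk0 x)) x)
      (indicator_nonneg (fun x _ => mul_nonneg hB0 (hk0 x)) x)
  calc ∫ x in Ioi (0 : ℝ), u x * k x
      ≤ ∫ x in Ioi (0 : ℝ), (J.indicator (fun x => E * k x) x +
          Jᶜ.indicator (fun x => B * k x) x) := by
        refine setIntegral_mono_on hint hgi.integrableOn measurableSet_Ioi fun x hx => ?_
        by_cases hxJ : x ∈ J
        · rw [indicator_of_mem hxJ, indicator_of_notMem (by simpa using hxJ), add_zero]
          refine mul_le_mul_of_nonneg_right ?_ (hk0 x)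
          have h1 := hgrow (y - a) (by linarith) (x - (y - a)) (by linarith [hxJ.1])
          rw [add_sub_cancel] at h1
          refine h1.trans (mul_le_mul_of_nonneg_right (Real.exp_le_exp.2 ?_) (h0 _))
          exact mul_le_mul_of_nonneg_left (by linarith [hxJ.2]) hC
        · rw [indicator_of_notMem hxJ, indicator_of_mem (by simpa using hxJ), zero_add]
          exact mul_le_mul_of_nonneg_right (hB x (le_of_lt hx)) (hk0 x)
    _ ≤ ∫ x, (J.indicator (fun x => E * k x) x + Jᶜ.indicator (fun x => B * k x) x) :=
        setIntegral_le_integral hgi (ae_of_all _ hg0)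
    _ = E * (∫ x in J, k x) + B * ((∫ x, k x) - ∫ x in J, k x) := by
        rw [integral_add ((hki.const_mul E).indicator measurableSet_Ioc)
          ((hki.const_mul B).indicator measurableSet_Ioc.compl),
          integral_indicator measurableSet_Ioc, integral_indicator measurableSet_Ioc.compl,
          integral_const_mul, integral_const_mul,
          ← integral_add_compl (μ := volume) measurableSet_Ioc hki]
        ring
    _ ≤ E * (∫ x, k x) + B * ((∫ x, k x) - ∫ x in J, k x) := by
        have := setIntegral_le_integral (s := J) hki (ae_of_all _ hk0)
        gcongr
    _ = _ := by
        simp only [hJ, hk]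
        rw [setIntegral_fejerKernel_Ioc hlam ha, integral_fejerKernel_comp hlam]
        ring

/-- **Wiener–Ikehara theorem** for nonnegative functions of at most exponential increase: if
`∫_0^∞ e^{-zx} u(x) dx - r / z` extends continuously to the closed right half-plane, then
`u x → r` as `x → ∞`. -/
theorem tendsto_of_laplaceInt_sub_extends {r : ℝ} (hm : Measurable u) (h0 : ∀ x, 0 ≤ u x)
    (hC : 0 ≤ C) (hgrow : ∀ x ≥ 0, ∀ t ≥ 0, u (x + t) ≤ Real.exp (C * t) * u x)
    (hu : Subexponential u)
    (hext : ∀ t : ℝ, ∃ l, Tendsto (fun z => laplaceInt u z - r / z)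
      (𝓝[{z | 0 < z.re}] (t * I)) (𝓝 l)) :
    Tendsto u atTop (𝓝 r) := by
  obtain ⟨H, hH, hHu⟩ : ∃ H : ℂ → ℂ, ContinuousOn H {z | 0 ≤ z.re} ∧
      ∀ z : ℂ, 0 < z.re → H z = laplaceInt u z - r / z := by
    have hat (z : ℂ) (hz : 0 < z.re) :
        Tendsto (fun z => laplaceInt u z - r / z) (𝓝[{z | 0 < z.re}] z)
          (𝓝 (laplaceInt u z - r / z)) := by
      have hz0 : z ≠ 0 := fun h => by simp [h] at hz
      exact (((hu.continuousAt_laplaceInt hm hz).sub (continuousAt_const.div continuousAt_id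
        hz0)).tendsto).mono_left nhdsWithin_le_nhds
    have hcl : {z : ℂ | 0 ≤ z.re} ⊆ closure {z : ℂ | 0 < z.re} := by
      rw [Complex.closure_setOfPred_lt_re]
    refine ⟨extendFrom {z | 0 < z.re} (fun z => laplaceInt u z - r / z),
      continuousOn_extendFrom hcl fun z hz => ?_, fun z hz =>
      extendFrom_eq (hcl (le_of_lt hz)) (hat z hz)⟩
    rcases (show 0 ≤ z.re from hz).eq_or_lt with h | h
    · obtain ⟨l, hl⟩ := hext z.im
      rw [show (z.im : ℂ) * I = z from Complex.ext (by simp [← h]) (by simp)] at hl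
      exact ⟨l, hl⟩
    · exact ⟨_, hat z h⟩
  set κ := ∫ w, fejerKernel w with hκ
  have hκ0 : 0 < κ := integral_fejerKernel_pos
  set P : ℝ → ℝ := fun b => ∫ w in (-b)..b, fejerKernel w with hP
  have hPlim : Tendsto P atTop (𝓝 κ) :=
    intervalIntegral_tendsto_integral integrable_fejerKernel tendsto_neg_atTop_atBot tendsto_id
  have hconv (lam : ℝ) (hlam : 0 < lam) :=
    exists_fejer_convolution hm h0 hu hH hHu hlam
  have hJ (lam : ℝ) (hlam : 0 < lam) : Tendsto (fun y => lam *
      ∫ x in Ioi (0 : ℝ), u x * fejerKernel (lam * (y - x))) atTop (𝓝 (r * κ)) := by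
    have := (hconv lam hlam).2.const_mul lam
    rwa [show lam * (r * (lam⁻¹ * κ)) = r * κ by field_simp] at this
  -- parameters: half-width `a` and scale `lam = a⁻¹ ^ 2` with `a → 0⁺`
  have hPa : Tendsto (fun a : ℝ => P (a⁻¹ ^ 2 * a)) (𝓝[>] 0) (𝓝 κ) := by
    refine hPlim.comp (tendsto_inv_nhdsGT_zero.congr' ?_)
    filter_upwards [self_mem_nhdsWithin] with a ha
    have : a ≠ 0 := (mem_Ioi.1 ha).ne'
    field_simp
  have hexpa (b : ℝ) : Tendsto (fun a : ℝ => Real.exp (C * (b * a))) (𝓝[>] 0) (𝓝 1) := by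
    have : Continuous fun a : ℝ => Real.exp (C * (b * a)) := by fun_prop
    simpa using (this.tendsto 0).mono_left nhdsWithin_le_nhds
  have hupper : ∀ r' > r, ∀ᶠ y in atTop, u y < r' := by
    intro r' hr'
    have hl : Tendsto (fun a : ℝ => Real.exp (C * (2 * a)) * (r * κ) / P (a⁻¹ ^ 2 * a))
        (𝓝[>] 0) (𝓝 r) := by
      have := ((hexpa 2).mul_const (r * κ)).div hPa hκ0.ne'
      rwa [one_mul, mul_div_cancel_right₀ _ hκ0.ne'] at this
    obtain ⟨a, ⟨ha1, ha2⟩, ha⟩ := ((((tendsto_order.1 hl).2 r' hr').and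
      ((tendsto_order.1 hPa).1 0 hκ0)).and self_mem_nhdsWithin).exists
    have ha0 : 0 < a := ha
    have hlam : 0 < a⁻¹ ^ 2 := by positivity
    have hlim := (((hJ _ hlam).comp (tendsto_atTop_add_const_right atTop (-a) tendsto_id)
      ).const_mul (Real.exp (C * (2 * a)))).div_const (P (a⁻¹ ^ 2 * a))
    filter_upwards [(tendsto_order.1 hlim).2 r' ha1, eventually_ge_atTop (2 * a)] with y hy1 hy2
    refine lt_of_le_of_lt ?_ hy1
    rw [le_div_iff₀ ha2]
    have := le_fejer_convolution h0 hC hgrow hlam ha0 (y := y - a) (by linarith)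
      ((hconv _ hlam).1 _)
    rw [sub_add_cancel] at this
    have h2 := mul_le_mul_of_nonneg_left this hlam.le
    rw [mul_left_comm, mul_inv_cancel_left₀ hlam.ne', mul_left_comm] at h2
    exact h2
  obtain ⟨B, hB⟩ := exists_bound_of_growth h0 hC hgrow (hupper (r + 1) (by linarith))
  refine tendsto_order.2 ⟨fun r' hr' => ?_, hupper⟩
  have hl : Tendsto (fun a : ℝ => (r * κ - B * (κ - P (a⁻¹ ^ 2 * a))) /
      (Real.exp (C * (2 * a)) * κ)) (𝓝[>] 0) (𝓝 r) := by
    have := (((hPa.const_sub κ).const_mul B).const_sub (r * κ)).div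
      ((hexpa 2).mul_const κ) (by simpa using hκ0.ne')
    simpa [hκ0.ne', Pi.div_def] using this
  obtain ⟨a, ha1, ha⟩ := (((tendsto_order.1 hl).1 r' hr').and self_mem_nhdsWithin).exists
  have ha0 : 0 < a := ha
  have hlam : 0 < a⁻¹ ^ 2 := by positivity
  have hlim := (((hJ _ hlam).comp (tendsto_atTop_add_const_right atTop a tendsto_id)
    ).sub_const (B * (κ - P (a⁻¹ ^ 2 * a)))).div_const (Real.exp (C * (2 * a)) * κ)
  filter_upwards [(tendsto_order.1 hlim).1 r' ha1, eventually_ge_atTop 0] with y hy1 hy2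
  refine hy1.trans_le ?_
  rw [div_le_iff₀ (by positivity)]
  have := fejer_convolution_le h0 hC hgrow hB hlam ha0 (y := y + a) (by linarith)
    ((hconv _ hlam).1 _)
  rw [add_sub_cancel_right] at this
  have h2 := mul_le_mul_of_nonneg_left this hlam.le
  rw [mul_inv_cancel_left₀ hlam.ne'] at h2
  simp only [Function.comp_apply, id]
  linarith

/-- **Abelian theorem**: if `u x → M`, then `ε ∫_0^∞ e^{-(ε+it)x} u(x) dx` tends to `M` for
`t = 0` and to `0` for `t ≠ 0`, as `ε → 0⁺`. -/
theorem tendsto_mul_laplaceInt {M B : ℝ} (hm : Measurable u) (hB : ∀ x ≥ 0, |u x| ≤ B)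
    (hM : Tendsto u atTop (𝓝 M)) (t : ℝ) :
    Tendsto (fun ε : ℝ => (ε : ℂ) * laplaceInt u (ε + t * I)) (𝓝[>] 0)
      (𝓝 (if t = 0 then (M : ℂ) else 0)) := by
  have hu : Subexponential u := fun ε hε => ⟨B, fun x hx => (hB x hx).trans
    (le_mul_of_one_le_right ((abs_nonneg _).trans (hB 0 le_rfl))
      (Real.one_le_exp (by positivity)))⟩
  have h1 : Tendsto (fun ε : ℝ => (ε : ℂ) * laplaceInt (fun x => u x - M) (ε + t * I))
      (𝓝[>] 0) (𝓝 0) := by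
    have hT : Tendsto (fun ε : ℝ => ∫ x in Ioi (0 : ℝ), Real.exp (-x) * |u (ε⁻¹ * x) - M|)
        (𝓝[>] 0) (𝓝 (∫ x in Ioi (0 : ℝ), Real.exp (-x) * 0)) := by
      refine tendsto_integral_filter_of_dominated_convergence
        (fun x => Real.exp (-x) * (B + |M|)) (Eventually.of_forall fun ε => by fun_prop) ?_
        ((integrableOn_exp_neg_Ioi 0).mul_const _) ?_
      · filter_upwards [self_mem_nhdsWithin] with ε hε
        refine (ae_restrict_iff' measurableSet_Ioi).2 (ae_of_all _ fun x hx => ?_)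
        rw [norm_mul, Real.norm_of_nonneg (Real.exp_nonneg _), Real.norm_eq_abs, abs_abs]
        have := hB (ε⁻¹ * x) (mul_nonneg (inv_nonneg.2 (le_of_lt hε)) (le_of_lt hx))
        gcongr
        exact (abs_sub _ _).trans (by gcongr)
      · refine (ae_restrict_iff' measurableSet_Ioi).2 (ae_of_all _ fun x hx => ?_)
        have := (hM.comp (tendsto_inv_nhdsGT_zero.atTop_mul_const hx)).sub_const M
        rw [sub_self] at this
        simpa using this.abs.const_mul (Real.exp (-x))
    simp only [mul_zero, integral_zero] at hT
    refine squeeze_zero_norm' ?_ hT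
    filter_upwards [self_mem_nhdsWithin] with ε hε
    have hε0 : 0 < ε := hε
    have hsub := integral_comp_mul_left_Ioi
      (fun x => Real.exp (-(ε * x)) * |u x - M|) 0 (inv_pos.2 hε0)
    rw [mul_zero, inv_inv, smul_eq_mul] at hsub
    rw [norm_mul, Complex.norm_real, Real.norm_of_nonneg hε0.le]
    calc ε * ‖laplaceInt (fun x => u x - M) (ε + t * I)‖
        ≤ ε * ∫ x in Ioi (0 : ℝ), Real.exp (-(ε * x)) * |u x - M| := by
          refine mul_le_mul_of_nonneg_left ?_ hε0.le
          refine (norm_integral_le_integral_norm _).trans (le_of_eq ?_)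
          refine integral_congr_ae (ae_of_all _ fun x => ?_)
          simp only [norm_mul, Complex.norm_exp, Complex.norm_real, Real.norm_eq_abs]
          simp
      _ = ∫ x in Ioi (0 : ℝ), Real.exp (-x) * |u (ε⁻¹ * x) - M| := by
          rw [← hsub]
          simp_rw [mul_inv_cancel_left₀ hε0.ne']
  have h2 : Tendsto (fun ε : ℝ => (ε : ℂ) * (M / (ε + t * I))) (𝓝[>] 0)
      (𝓝 (if t = 0 then (M : ℂ) else 0)) := by
    split_ifs with ht
    · refine tendsto_const_nhds.congr' ?_
      filter_upwards [self_mem_nhdsWithin] with ε hε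
      have : (ε : ℂ) ≠ 0 := by exact_mod_cast (mem_Ioi.1 hε).ne'
      rw [ht, Complex.ofReal_zero, zero_mul, add_zero, mul_div_cancel₀ _ this]
    · have hc : ContinuousAt (fun ε : ℝ => (ε : ℂ) * (M / (ε + t * I))) 0 := by
        refine ContinuousAt.mul (by fun_prop) (ContinuousAt.div (by fun_prop) (by fun_prop) ?_)
        simpa using ht
      have := hc.tendsto
      simp only [Complex.ofReal_zero, zero_mul] at this
      exact this.mono_left nhdsWithin_le_nhds
  have h3 := h1.add h2
  rw [zero_add] at h3
  refine h3.congr' ?_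
  filter_upwards [self_mem_nhdsWithin] with ε hε
  rw [laplaceInt_sub_const hm hu M (by simpa using hε)]
  ring

end Tauberian

lemma tendsto_of_tendsto_mul_sub {F : ℂ → ℂ} {ω : ℂ} (hF : MeromorphicAt F ω)
    (h : Tendsto (fun s => (s - ω) * F s) (𝓝[≠] ω) (𝓝 0)) :
    ∃ l, Tendsto F (𝓝[≠] ω) (𝓝 l) := by
  have hid : MeromorphicAt (fun s => s - ω) ω := by fun_prop
  rw [tendsto_nhds_iff_meromorphicOrderAt_nonneg hF]
  have h1 := (tendsto_zero_iff_meromorphicOrderAt_pos (hid.mul hF)).1 h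
  rw [meromorphicOrderAt_mul hid hF, meromorphicOrderAt_id_sub_const] at h1
  cases ho : meromorphicOrderAt F ω with
  | top => exact le_top
  | coe n =>
    rw [ho] at h1
    norm_cast at h1 ⊢
    omega

lemma tendsto_add_ofReal_nhdsGT (ω : ℂ) :
    Tendsto (fun ε : ℝ => ω + ε) (𝓝[>] 0) (𝓝[≠] ω) := by
  refine tendsto_nhdsWithin_iff.2 ⟨?_, ?_⟩
  · have : Continuous fun ε : ℝ => ω + ε := by fun_prop
    simpa using (this.tendsto 0).mono_left nhdsWithin_le_nhds
  · filter_upwards [self_mem_nhdsWithin] with ε hε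
    simpa using (mem_Ioi.1 hε).ne'

lemma MeromorphicAt.tendsto_of_tendsto_ray {h : ℂ → ℂ} {ω l : ℂ} (hh : MeromorphicAt h ω)
    (hray : Tendsto (fun ε : ℝ => h (ω + ε)) (𝓝[>] 0) (𝓝 l)) : Tendsto h (𝓝[≠] ω) (𝓝 l) := by
  rcases lt_or_ge (meromorphicOrderAt h ω) 0 with ho | ho
  · have h1 := (tendsto_norm_cobounded_atTop.comp
      (tendsto_cobounded_of_meromorphicOrderAt_neg ho)).comp (tendsto_add_ofReal_nhdsGT ω)
    exact absurd hray.norm (not_tendsto_nhds_of_tendsto_atTop h1 _)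
  · obtain ⟨c, hc⟩ := (tendsto_nhds_iff_meromorphicOrderAt_nonneg hh).2 ho
    rwa [tendsto_nhds_unique hray (hc.comp (tendsto_add_ofReal_nhdsGT ω))]

section TubeVolume

variable {N : ℕ} {A Ω : Set (EuclideanSpace ℝ (Fin N))} {D δ : ℝ}

lemma monotone_tubeVol (hΩ : volume Ω < ⊤) : Monotone (tubeVol N A Ω) := fun _ _ hst =>
  ENNReal.toReal_mono ((measure_mono inter_subset_right).trans_lt hΩ).ne
    (measure_mono (inter_subset_inter_left _ fun _ hx => lt_of_lt_of_le hx hst))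

lemma tubeVol_nonneg (t : ℝ) : 0 ≤ tubeVol N A Ω t := ENNReal.toReal_nonneg

/-- The normalized tube volume `|A_t ∩ Ω| / t ^ (N - D)` at `t = δ * exp (-y)`. -/
def logTube (N : ℕ) (A Ω : Set (EuclideanSpace ℝ (Fin N))) (D δ y : ℝ) : ℝ :=
  tubeVol N A Ω (δ * Real.exp (-y)) / (δ * Real.exp (-y)) ^ ((N : ℝ) - D)

lemma measurable_logTube (hΩ : volume Ω < ⊤) : Measurable (logTube N A Ω D δ) := by
  have := (monotone_tubeVol (A := A) hΩ).measurable
  unfold logTube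
  fun_prop

lemma logTube_nonneg (hδ : 0 < δ) (y : ℝ) : 0 ≤ logTube N A Ω D δ y :=
  div_nonneg (tubeVol_nonneg _) (by positivity)

lemma logTube_add_le (hΩ : volume Ω < ⊤) (hδ : 0 < δ) (y : ℝ) {t : ℝ} (ht : 0 ≤ t) :
    logTube N A Ω D δ (y + t) ≤ Real.exp (|(N : ℝ) - D| * t) * logTube N A Ω D δ y := by
  have hV : tubeVol N A Ω (δ * Real.exp (-(y + t))) ≤ tubeVol N A Ω (δ * Real.exp (-y)) := by
    refine monotone_tubeVol hΩ ?_
    gcongr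
    linarith
  have hsplit : (δ * Real.exp (-(y + t))) ^ ((N : ℝ) - D) =
      (δ * Real.exp (-y)) ^ ((N : ℝ) - D) * Real.exp (-(((N : ℝ) - D) * t)) := by
    rw [neg_add, Real.exp_add, ← mul_assoc, Real.mul_rpow (by positivity) (by positivity),
      ← Real.exp_mul]
    ring_nf
  unfold logTube
  rw [hsplit, div_mul_eq_div_div, div_eq_mul_inv _ (Real.exp (-(((N : ℝ) - D) * t))),
    ← Real.exp_neg, neg_neg, mul_comm (Real.exp _)]
  have : ((N : ℝ) - D) * t ≤ |(N : ℝ) - D| * t := mul_le_mul_of_nonneg_right (le_abs_self _) ht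
  gcongr
  exact logTube_nonneg hδ y

lemma tendsto_logTube_iff (hδ : 0 < δ) (M : ℝ) :
    Tendsto (logTube N A Ω D δ) atTop (𝓝 M) ↔
      Tendsto (fun t => tubeVol N A Ω t / t ^ ((N : ℝ) - D)) (𝓝[>] 0) (𝓝 M) := by
  constructor
  · intro h
    have h1 : Tendsto (fun t => -Real.log (δ⁻¹ * t)) (𝓝[>] 0) atTop := by
      refine tendsto_neg_atBot_atTop.comp (Real.tendsto_log_nhdsGT_zero.comp ?_)
      refine tendsto_nhdsWithin_iff.2 ⟨?_, ?_⟩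
      · have : Continuous fun t : ℝ => δ⁻¹ * t := by fun_prop
        simpa using (this.tendsto 0).mono_left nhdsWithin_le_nhds
      · filter_upwards [self_mem_nhdsWithin] with t ht
        exact mul_pos (inv_pos.2 hδ) ht
    refine (h.comp h1).congr' ?_
    filter_upwards [self_mem_nhdsWithin] with t ht
    have : δ * Real.exp (- -Real.log (δ⁻¹ * t)) = t := by
      rw [neg_neg, Real.exp_log (mul_pos (inv_pos.2 hδ) ht), mul_inv_cancel_left₀ hδ.ne']
    simp only [Function.comp_apply, logTube, this]
  · intro h
    have h1 : Tendsto (fun y => δ * Real.exp (-y)) atTop (𝓝[>] 0) := by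
      refine tendsto_nhdsWithin_iff.2 ⟨?_, Eventually.of_forall fun y =>
        mul_pos hδ (Real.exp_pos _)⟩
      simpa using (Real.tendsto_exp_neg_atTop_nhds_zero).const_mul δ
    exact h.comp h1

lemma subexponential_logTube (hΩ : volume Ω < ⊤) (hδ : 0 < δ)
    (hD : IsUpperMinkDim N A Ω D) : Subexponential (logTube N A Ω D δ) := by
  intro ε hε
  obtain ⟨r, hr, -, hrD⟩ := hD.exists_between (show D < D + ε by linarith)
  have hlt : upperContent N A Ω r < 1 := by
    rw [show upperContent N A Ω r = 0 from hr]
    exact zero_lt_one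
  have hev := eventually_lt_of_limsup_lt hlt
  have h1 : Tendsto (fun y => δ * Real.exp (-y)) atTop (𝓝[>] 0) :=
    tendsto_nhdsWithin_iff.2 ⟨by simpa using (Real.tendsto_exp_neg_atTop_nhds_zero).const_mul δ,
      Eventually.of_forall fun y => mul_pos hδ (Real.exp_pos _)⟩
  obtain ⟨Y, hY⟩ := eventually_atTop.1 (h1.eventually hev)
  refine ⟨max (δ ^ (D - r)) (Real.exp (|(N : ℝ) - D| * Y) * logTube N A Ω D δ 0),
    fun y hy => ?_⟩
  rw [abs_of_nonneg (logTube_nonneg hδ y)]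
  rcases le_total Y y with h | h
  · refine le_trans ?_ (mul_le_mul_of_nonneg_right (le_max_left _ _) (Real.exp_nonneg _))
    have hpos : 0 < δ * Real.exp (-y) := by positivity
    have hle : tubeVol N A Ω (δ * Real.exp (-y)) ≤ (δ * Real.exp (-y)) ^ ((N : ℝ) - r) := by
      have h2 := hY y h
      have h3 : 0 < (δ * Real.exp (-y)) ^ ((N : ℝ) - r) := by positivity
      rw [ENNReal.div_lt_iff (Or.inl (ENNReal.ofReal_pos.2 h3).ne')
        (Or.inl ENNReal.ofReal_ne_top), one_mul] at h2
      exact ENNReal.toReal_le_of_le_ofReal h3.le h2.le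
    calc logTube N A Ω D δ y
        ≤ (δ * Real.exp (-y)) ^ ((N : ℝ) - r) / (δ * Real.exp (-y)) ^ ((N : ℝ) - D) := by
          unfold logTube; gcongr
      _ = δ ^ (D - r) * Real.exp ((r - D) * y) := by
          rw [← Real.rpow_sub hpos, Real.mul_rpow hδ.le (Real.exp_nonneg _), ← Real.exp_mul]
          ring_nf
      _ ≤ δ ^ (D - r) * Real.exp (ε * y) := by
          gcongr
          linarith
  · refine le_trans ?_ (le_mul_of_one_le_right (le_max_of_le_left (by positivity))
      (Real.one_le_exp (by positivity)))
    exact le_max_of_le_right (le_exp_mul_of_growth (logTube_nonneg hδ) (abs_nonneg _)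
      (fun x _ t ht => logTube_add_le hΩ hδ x ht) hy h)

lemma tubeZeta_eq_laplaceInt (hδ : 0 < δ) (z : ℂ) :
    tubeZeta N A Ω δ (D + z) = (δ : ℂ) ^ z * laplaceInt (logTube N A Ω D δ) z := by
  have himg : (fun y => δ * Real.exp (-y)) '' Ioi 0 = Ioo 0 δ := by
    ext t
    constructor
    · rintro ⟨y, hy, rfl⟩
      refine ⟨by positivity, mul_lt_of_lt_one_right hδ (Real.exp_lt_one_iff.mpr ?_)⟩
      simpa using hy
    · rintro ⟨ht0, htδ⟩
      refine ⟨-Real.log (δ⁻¹ * t), ?_, ?_⟩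
      · rw [mem_Ioi, neg_pos]
        refine Real.log_neg (by positivity) ?_
        rwa [inv_mul_lt_iff₀ hδ, mul_one]
      · simp only [neg_neg]
        rw [Real.exp_log (by positivity), mul_inv_cancel_left₀ hδ.ne']
  have hder (y : ℝ) : HasDerivAt (fun y => δ * Real.exp (-y)) (-(δ * Real.exp (-y))) y := by
    simpa using ((hasDerivAt_neg y).exp).const_mul δ
  rw [tubeZeta, integral_Ioc_eq_integral_Ioo, ← himg, integral_image_eq_integral_abs_deriv_smul
    measurableSet_Ioi (fun y _ => (hder y).hasDerivWithinAt)
    (fun x _ y _ h => by simpa [hδ.ne'] using h), laplaceInt, ← integral_const_mul]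
  refine integral_congr_ae (ae_of_all _ fun y => ?_)
  have hpos : 0 < δ * Real.exp (-y) := by positivity
  have hδ' : (δ : ℂ) ≠ 0 := by exact_mod_cast hδ.ne'
  have h1 : ((δ * Real.exp (-y) : ℝ) : ℂ) ^ z = (δ : ℂ) ^ z * cexp (-z * y) := by
    rw [Complex.ofReal_mul, Complex.mul_cpow_ofReal_nonneg hδ.le (Real.exp_nonneg _)]
    congr 1
    rw [Complex.cpow_def_of_ne_zero (by exact_mod_cast (Real.exp_pos _).ne'),
      ← Complex.ofReal_log (Real.exp_nonneg _), Real.log_exp]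
    push_cast
    ring_nf
  set t := δ * Real.exp (-y) with ht
  have ht0 : (t : ℂ) ≠ 0 := by exact_mod_cast hpos.ne'
  have h2 : (t : ℂ) ^ ((D : ℂ) + z - N - 1) = (t : ℂ) ^ z / (t : ℂ) ^ ((N : ℂ) - D) / t := by
    rw [Complex.cpow_sub _ _ ht0, Complex.cpow_one, ← Complex.cpow_sub _ _ ht0]
    ring_nf
  have h3 : (logTube N A Ω D δ y : ℂ) = tubeVol N A Ω t / (t : ℂ) ^ ((N : ℂ) - D) := by
    rw [logTube, ← ht, Complex.ofReal_div, Complex.ofReal_cpow hpos.le]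
    push_cast
    rfl
  simp only
  rw [← ht, h3, h2, ← mul_assoc, ← h1, abs_neg, abs_of_pos hpos, Complex.real_smul]
  field_simp

end TubeVolume

/-- Minkowski measurability criterion in terms of `ζ̃_{A,Ω}`.
Let `(A,Ω)` be an RFD in `ℝ^N` with `D := dim_B(A,Ω)`, and fix `δ > 0`.
Let `S` be a screen with `sup S < D`, `U` an open connected neighborhood of the window
`W`, and `F` a meromorphic extension of `ζ̃_{A,Ω}(·;δ)` to `U` satisfying (L1)–(L2)
with some exponent `κ`.  Assume the screen passes strictly between the critical line
`{Re s = D}` and all poles of `F` with real part `< D`.  Then `(A,Ω)` is Minkowski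
measurable iff `D` is the only pole of `F` on `{Re s = D}` and it is simple; and in
that case `M^D(A,Ω) = r`, the residue of `F` at `D`. -/
theorem statement17
    (N : ℕ) (A Ω : Set (EuclideanSpace ℝ (Fin N))) (D δ : ℝ)
    (S : ℝ → ℝ) (U : Set ℂ) (F : ℂ → ℂ) (κ c C : ℝ) (T : ℤ → ℝ)
    (hRFD : IsRFD N A Ω) (hD : IsMinkDim N A Ω D) (hδ : 0 < δ)
    (hscreen : IsScreen S D) (hSbdd : BddAbove (Set.range S))
    (hSlt : sSup (Set.range S) < D)
    (hU : IsOpen U) (hUconn : IsPreconnected U) (hWU : window S ⊆ U)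
    (hF : MeromorphicOn F U)
    (hFzeta : ∀ s ∈ U, D < s.re → F s = tubeZeta N A Ω δ s)
    (hc : (N : ℝ) < c)
    (hlang : LanguidWith F S κ c C T)
    (hpoles : ∀ ω ∈ U, IsPoleAt F ω → ω.re < D → ω.re < S ω.im) :
    ((∃ M : ℝ, MinkMeasurable N A Ω D M) ↔
      ((∃ r : ℂ, r ≠ 0 ∧
          Tendsto (fun s : ℂ => (s - (D : ℂ)) * F s)
            (nhdsWithin (D : ℂ) {(D : ℂ)}ᶜ) (nhds r)) ∧
        ∀ ω ∈ U, ω.re = D → IsPoleAt F ω → ω = (D : ℂ))) ∧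
    ∀ r : ℂ,
      Tendsto (fun s : ℂ => (s - (D : ℂ)) * F s)
        (nhdsWithin (D : ℂ) {(D : ℂ)}ᶜ) (nhds r) →
      (∃ M : ℝ, MinkMeasurable N A Ω D M) →
      ∃ M : ℝ, MinkMeasurable N A Ω D M ∧ (M : ℂ) = r := by
  have hΩ := hRFD.2.2.1
  set u := logTube N A Ω D δ with hu
  have hm : Measurable u := measurable_logTube hΩ
  have h0 : ∀ y, 0 ≤ u y := logTube_nonneg hδ
  have hgrow : ∀ x ≥ 0, ∀ t ≥ 0, u (x + t) ≤ Real.exp (|(N : ℝ) - D| * t) * u x :=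
    fun x _ t ht => logTube_add_le hΩ hδ x ht
  have hsub : Subexponential u := subexponential_logTube hΩ hδ hD.1
  have hδ' : (δ : ℂ) ≠ 0 := by exact_mod_cast hδ.ne'
  have hmem (s : ℂ) (hs : D ≤ s.re) : s ∈ U :=
    hWU (((le_csSup hSbdd (mem_range_self _)).trans hSlt.le).trans hs)
  have hFu (z : ℂ) (hz : 0 < z.re) : F (D + z) = (δ : ℂ) ^ z * laplaceInt u z := by
    rw [hFzeta _ (hmem _ (by simpa using hz.le)) (by simpa using hz), tubeZeta_eq_laplaceInt hδ]
  have hpow : Continuous fun z : ℂ => (δ : ℂ) ^ z := by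
    exact continuous_const.cpow continuous_id fun z => Or.inl (by simpa using hδ)
  have hmero (ω : ℂ) (hω : ω.re = D) : MeromorphicAt F ω := hF ω (hmem ω hω.ge)
  have abelian {M : ℝ} (hM : MinkMeasurable N A Ω D M) (t : ℝ) :
      Tendsto (fun s => (s - (D + t * I)) * F s) (𝓝[≠] (D + t * I))
        (𝓝 (if t = 0 then (M : ℂ) else 0)) := by
    have huM := (tendsto_logTube_iff hδ M).2 hM.2
    obtain ⟨B, hB⟩ := exists_bound_of_growth h0 (abs_nonneg _) hgrow
      ((tendsto_order.1 huM).2 (M + 1) (by linarith))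
    have hmF := hmero (D + t * I) (by simp)
    refine MeromorphicAt.tendsto_of_tendsto_ray (by fun_prop) ?_
    have h1 := tendsto_mul_laplaceInt hm (fun x hx => by rw [abs_of_nonneg (h0 x)]; exact hB x hx)
      huM t
    have h2 : Tendsto (fun ε : ℝ => (δ : ℂ) ^ ((ε : ℂ) + t * I)) (𝓝[>] 0)
        (𝓝 ((δ : ℂ) ^ (t * I))) := by
      have : Continuous fun ε : ℝ => (δ : ℂ) ^ ((ε : ℂ) + t * I) := hpow.comp (by fun_prop)
      simpa using (this.tendsto 0).mono_left nhdsWithin_le_nhds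
    have h3 := h2.mul h1
    have h4 : (δ : ℂ) ^ (t * I) * (if t = 0 then (M : ℂ) else 0) =
        if t = 0 then (M : ℂ) else 0 := by
      split_ifs with ht <;> simp [ht]
    rw [h4] at h3
    refine h3.congr' ?_
    filter_upwards [self_mem_nhdsWithin] with ε hε
    rw [show (D : ℂ) + t * I + ε = D + (ε + t * I) by ring, hFu _ (by simpa using hε)]
    ring
  have residue {M : ℝ} (hM : MinkMeasurable N A Ω D M) :
      Tendsto (fun s : ℂ => (s - (D : ℂ)) * F s) (𝓝[≠] (D : ℂ)) (𝓝 (M : ℂ)) := by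
    simpa using abelian hM 0
  refine ⟨⟨?_, ?_⟩, ?_⟩
  · rintro ⟨M, hM⟩
    refine ⟨⟨M, by exact_mod_cast hM.1.ne', residue hM⟩, fun ω hωU hω hpole => ?_⟩
    have hωeq : ω = D + ω.im * I := Complex.ext (by simp [hω]) (by simp)
    by_contra hne
    have him : ω.im ≠ 0 := fun h => hne (by rw [hωeq, h]; simp)
    have h1 := abelian hM ω.im
    rw [← hωeq, if_neg him] at h1
    obtain ⟨l, hl⟩ := tendsto_of_tendsto_mul_sub (hF ω hωU) h1
    exact not_tendsto_nhds_of_tendsto_atTop hpole _ hl.norm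
  · rintro ⟨⟨r, hr0, hr⟩, hpole⟩
    have hray : Tendsto (fun ε : ℝ => ((ε * (δ ^ ε *
        ∫ x in Ioi (0 : ℝ), Real.exp (-ε * x) * u x) : ℝ) : ℂ)) (𝓝[>] 0) (𝓝 r) := by
      refine (hr.comp (tendsto_add_ofReal_nhdsGT D)).congr' ?_
      filter_upwards [self_mem_nhdsWithin] with ε hε
      have : laplaceInt u ε = ((∫ x in Ioi (0 : ℝ), Real.exp (-ε * x) * u x : ℝ) : ℂ) := by
        refine Eq.trans ?_ integral_ofReal
        simp [laplaceInt]
      simp only [Function.comp_apply]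
      rw [hFu _ (by simpa using hε), this, add_sub_cancel_left, Complex.ofReal_mul,
        Complex.ofReal_mul, Complex.ofReal_cpow hδ.le]
    have him : r.im = 0 := by
      have := (Complex.continuous_im.tendsto r).comp hray
      simp only [Function.comp_def, Complex.ofReal_im] at this
      exact (tendsto_nhds_unique this tendsto_const_nhds)
    have hre : 0 ≤ r.re := by
      have := (Complex.continuous_re.tendsto r).comp hray
      simp only [Function.comp_def, Complex.ofReal_re] at this
      refine ge_of_tendsto this ?_
      filter_upwards [self_mem_nhdsWithin] with ε hε
      have hε0 : 0 < ε := hε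
      have : 0 ≤ ∫ x in Ioi (0 : ℝ), Real.exp (-ε * x) * u x :=
        integral_nonneg fun x => mul_nonneg (Real.exp_nonneg _) (h0 x)
      positivity
    obtain ⟨ρ, rfl⟩ : ∃ ρ : ℝ, r = ρ := ⟨r.re, Complex.ext rfl (by simp [him])⟩
    have hρ : 0 < ρ := lt_of_le_of_ne hre fun h => hr0 (by simpa using h.symm)
    refine ⟨ρ, hρ, (tendsto_logTube_iff hδ ρ).1 ?_⟩
    refine tendsto_of_laplaceInt_sub_extends hm h0 (abs_nonneg _) hgrow hsub fun t => ?_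
    have hshift : Tendsto (fun z : ℂ => (D : ℂ) + z) (𝓝[≠] (t * I)) (𝓝[≠] (D + t * I)) := by
      refine tendsto_nhdsWithin_iff.2 ⟨?_, ?_⟩
      · have : Continuous fun z : ℂ => (D : ℂ) + z := by fun_prop
        exact (this.tendsto _).mono_left nhdsWithin_le_nhds
      · filter_upwards [self_mem_nhdsWithin] with z hz
        simpa using hz
    have hpow' : Continuous fun z : ℂ => (δ : ℂ) ^ (-z) := hpow.comp continuous_neg
    suffices ∃ l, Tendsto (fun z => (δ : ℂ) ^ (-z) * F (D + z) - ρ / z) (𝓝[≠] (t * I)) (𝓝 l) by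
      obtain ⟨l, hl⟩ := this
      refine ⟨l, (hl.mono_left (nhdsWithin_mono _ fun z hz h => ?_)).congr' ?_⟩
      · rw [mem_singleton_iff.1 h] at hz
        simp at hz
      · filter_upwards [self_mem_nhdsWithin] with z hz
        rw [hFu z hz, ← mul_assoc, ← Complex.cpow_add _ _ hδ', neg_add_cancel,
          Complex.cpow_zero, one_mul]
    have hpowT : Tendsto (fun z : ℂ => (δ : ℂ) ^ (-z)) (𝓝[≠] (t * I)) (𝓝 ((δ : ℂ) ^ (-(t * I)))) :=
      (hpow'.tendsto _).mono_left nhdsWithin_le_nhds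
    by_cases ht : t = 0
    · subst ht
      simp only [Complex.ofReal_zero, zero_mul, add_zero, neg_zero, Complex.cpow_zero]
        at hshift hpowT ⊢
      refine tendsto_of_tendsto_mul_sub ?_ ?_
      · have h1 : MeromorphicAt (fun z : ℂ => F (D + z)) 0 := by
          have hmF := hmero D (by simp)
          rw [← add_zero (D : ℂ)] at hmF
          exact hmF.comp_analyticAt (by fun_prop)
        have h2 : MeromorphicAt (fun z : ℂ => (δ : ℂ) ^ (-z)) 0 := by
          refine AnalyticAt.meromorphicAt (Differentiable.analyticAt ?_ 0)
          intro z
          exact (differentiableAt_id.neg).const_cpow (Or.inl hδ')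
        exact (h2.mul h1).sub ((MeromorphicAt.const _ _).div (MeromorphicAt.id _))
      · have h1 := (hpowT.mul (hr.comp hshift)).sub_const (ρ : ℂ)
        rw [one_mul, sub_self] at h1
        refine h1.congr' ?_
        filter_upwards [self_mem_nhdsWithin] with z hz
        have : z ≠ 0 := hz
        simp only [Function.comp_apply, add_sub_cancel_left, sub_zero]
        field_simp
    · have hnp : ¬ IsPoleAt F (D + t * I) := fun h => ht (by
        simpa using hpole _ (hmem _ (by simp)) (by simp) h)
      have hmF := hmero (D + t * I) (by simp)
      have hord : 0 ≤ meromorphicOrderAt F (D + t * I) := by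
        by_contra! h
        exact hnp (tendsto_norm_cobounded_atTop.comp
          (tendsto_cobounded_of_meromorphicOrderAt_neg h))
      obtain ⟨l, hl⟩ := (tendsto_nhds_iff_meromorphicOrderAt_nonneg hmF).2 hord
      have htI : (t * I : ℂ) ≠ 0 := mul_ne_zero (by exact_mod_cast ht) I_ne_zero
      have hdiv : Tendsto (fun z : ℂ => (ρ : ℂ) / z) (𝓝[≠] (t * I)) (𝓝 (ρ / (t * I))) :=
        ((continuousAt_const.div continuousAt_id htI).tendsto).mono_left nhdsWithin_le_nhds
      exact ⟨_, (hpowT.mul (hl.comp hshift)).sub hdiv⟩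
  · rintro r hr ⟨M, hM⟩
    exact ⟨M, hM, tendsto_nhds_unique (residue hM) hr⟩

end
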